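/- For every α > 0 there is a constant C_α > 0 such that for all smooth divergence-free vector fields u, v : 𝕋² → ℝ², one has |b(u,v,u)| ≤ α ‖∂₁u‖²_{L²} + C_α (1 + ‖v‖²_{H^{1,1}}) ‖u‖²_{L²}. -/

import Mathlib

open MeasureTheory Real Complex Filter Set

noncomputable section

namespace Aniso

/-- Fundamental domain `(0, 2π]` for the circle of circumference `2π`. -/
def I2pi : Set ℝ := Set.Ioc 0 (2 * π)

/-- Fundamental domain for the 2-torus `𝕋² = (ℝ/2πℤ)²`. -/
def Q2 : Set (ℝ × ℝ) := I2pi ×ˢ I2pi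

/-- Integral over the torus of a real function. -/
def tintR (f : ℝ × ℝ → ℝ) : ℝ := ∫ x in Q2, f x

/-- Smoothness of a scalar field. -/
def Smooth (f : ℝ × ℝ → ℝ) : Prop := ContDiff ℝ (⊤ : ℕ∞) f

/-- Smoothness of a vector field. -/
def SmoothV (u : ℝ × ℝ → ℝ × ℝ) : Prop := ContDiff ℝ (⊤ : ℕ∞) u

/-- `2π`-periodicity in each variable: this encodes being a function on the torus. -/
def Per (f : ℝ × ℝ → ℝ) : Prop :=
  (∀ x : ℝ × ℝ, f (x.1 + 2 * π, x.2) = f x) ∧ (∀ x : ℝ × ℝ, f (x.1, x.2 + 2 * π) = f x)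

def PerV (u : ℝ × ℝ → ℝ × ℝ) : Prop :=
  Per (fun x => (u x).1) ∧ Per (fun x => (u x).2)

/-- Partial derivative in the horizontal variable `x₁`. -/
def pd1 (f : ℝ × ℝ → ℝ) : ℝ × ℝ → ℝ := fun x => fderiv ℝ f x (1, 0)

/-- Partial derivative in the vertical variable `x₂`. -/
def pd2 (f : ℝ × ℝ → ℝ) : ℝ × ℝ → ℝ := fun x => fderiv ℝ f x (0, 1)

def comp1 (u : ℝ × ℝ → ℝ × ℝ) : ℝ × ℝ → ℝ := fun x => (u x).1
def comp2 (u : ℝ × ℝ → ℝ × ℝ) : ℝ × ℝ → ℝ := fun x => (u x).2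

def pd1V (u : ℝ × ℝ → ℝ × ℝ) : ℝ × ℝ → ℝ × ℝ := fun x => (pd1 (comp1 u) x, pd1 (comp2 u) x)
def pd2V (u : ℝ × ℝ → ℝ × ℝ) : ℝ × ℝ → ℝ × ℝ := fun x => (pd2 (comp1 u) x, pd2 (comp2 u) x)

/-- Divergence-free condition `∂₁u¹ + ∂₂u² = 0`. -/
def DivFree (u : ℝ × ℝ → ℝ × ℝ) : Prop :=
  ∀ x, pd1 (comp1 u) x + pd2 (comp2 u) x = 0

/-- The transport term `u·∇v`, with components `u¹∂₁vʲ + u²∂₂vʲ`. -/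
def advect (u v : ℝ × ℝ → ℝ × ℝ) : ℝ × ℝ → ℝ × ℝ := fun x =>
  ((u x).1 * pd1 (comp1 v) x + (u x).2 * pd2 (comp1 v) x,
   (u x).1 * pd1 (comp2 v) x + (u x).2 * pd2 (comp2 v) x)

/-- L² inner product of real vector fields on the torus (summed over components). -/
def ipV (u v : ℝ × ℝ → ℝ × ℝ) : ℝ := tintR fun x => (u x).1 * (v x).1 + (u x).2 * (v x).2

/-- The trilinear form `b(u,v,w) = ∫ (u·∇v)·w`. -/
def b3 (u v w : ℝ × ℝ → ℝ × ℝ) : ℝ := ipV (advect u v) w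

/-- L² norm of a scalar function on the torus. -/
def L2 (f : ℝ × ℝ → ℝ) : ℝ := Real.sqrt (tintR fun x => f x ^ 2)

/-- L² norm of a vector field on the torus. -/
def L2V (u : ℝ × ℝ → ℝ × ℝ) : ℝ := Real.sqrt (tintR fun x => (u x).1 ^ 2 + (u x).2 ^ 2)

/-- Fourier coefficient of a complex-valued function on the torus. -/
def fcC (f : ℝ × ℝ → ℂ) (k : ℤ × ℤ) : ℂ :=
  (1 / (2 * π) ^ 2 : ℂ) *
    ∫ x in Q2, f x * Complex.exp (-(Complex.I) * ((k.1 : ℂ) * (x.1 : ℂ) + (k.2 : ℂ) * (x.2 : ℂ)))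

/-- Fourier coefficient of a real-valued function on the torus. -/
def fc (f : ℝ × ℝ → ℝ) (k : ℤ × ℤ) : ℂ := fcC (fun x => (f x : ℂ)) k

/-- Anisotropic Sobolev weight `(1+|k₁|²)^s (1+|k₂|²)^{s'}`. -/
def aw (s s' : ℝ) (k : ℤ × ℤ) : ℝ :=
  (1 + (k.1 : ℝ) ^ 2) ^ s * (1 + (k.2 : ℝ) ^ 2) ^ s'

/-- Square of the anisotropic Sobolev norm `H^{s,s'}` of a scalar function. -/
def HSq (s s' : ℝ) (f : ℝ × ℝ → ℝ) : ℝ := ∑' k : ℤ × ℤ, aw s s' k * ‖fc f k‖ ^ 2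

/-- Anisotropic Sobolev norm `H^{s,s'}` of a scalar function. -/
def HN (s s' : ℝ) (f : ℝ × ℝ → ℝ) : ℝ := Real.sqrt (HSq s s' f)

/-- Anisotropic Sobolev norm `H^{s,s'}` of a vector field. -/
def HNV (s s' : ℝ) (u : ℝ × ℝ → ℝ × ℝ) : ℝ :=
  Real.sqrt (HSq s s' (comp1 u) + HSq s s' (comp2 u))

/-- Mixed norm `L^∞_h(L²_v)`. -/
def LinfhL2v (f : ℝ × ℝ → ℝ) : ℝ :=
  essSup (fun x1 : ℝ => Real.sqrt (∫ x2 in I2pi, f (x1, x2) ^ 2)) (volume.restrict I2pi)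

/-- Mixed norm `L²_h(L^∞_v)`. -/
def L2hLinfv (f : ℝ × ℝ → ℝ) : ℝ :=
  Real.sqrt (∫ x1 in I2pi, (essSup (fun x2 : ℝ => |f (x1, x2)|) (volume.restrict I2pi)) ^ 2)

/-- Mixed norm `L²_v(L^{4/3}_h)`. -/
def L2vL43h {E : Type*} [NormedAddCommGroup E] (f : ℝ × ℝ → E) : ℝ :=
  Real.sqrt (∫ x2 in I2pi, (∫ x1 in I2pi, ‖f (x1, x2)‖ ^ ((4 : ℝ)/3)) ^ ((3 : ℝ)/2))

/-- Mixed norm `L^∞_v(L²_h)`. -/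
def LinfvL2h {E : Type*} [NormedAddCommGroup E] (f : ℝ × ℝ → E) : ℝ :=
  essSup (fun x2 : ℝ => Real.sqrt (∫ x1 in I2pi, ‖f (x1, x2)‖ ^ 2)) (volume.restrict I2pi)

/-- Mixed norm `L²_v(L⁴_h)`. -/
def L2vL4h {E : Type*} [NormedAddCommGroup E] (f : ℝ × ℝ → E) : ℝ :=
  Real.sqrt (∫ x2 in I2pi, Real.sqrt (∫ x1 in I2pi, ‖f (x1, x2)‖ ^ 4))

/-- One-dimensional Fourier coefficient on the circle of circumference `2π`. -/
def fc1 (g : ℝ → ℂ) (n : ℤ) : ℂ :=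
  (1 / (2 * π) : ℂ) * ∫ x in I2pi, g x * Complex.exp (-(Complex.I) * ((n : ℂ) * (x : ℂ)))

/-- Square of the 1-d Sobolev norm `H^s(𝕋)`. -/
def H1Sq (s : ℝ) (g : ℝ → ℂ) : ℝ := ∑' n : ℤ, (1 + (n : ℝ) ^ 2) ^ s * ‖fc1 g n‖ ^ 2

/-- Mixed norm `L²_v(H^s_h)`. -/
def L2vHsh (s : ℝ) (f : ℝ × ℝ → ℂ) : ℝ :=
  Real.sqrt (∫ x2 in I2pi, H1Sq s (fun x1 => f (x1, x2)))

/-- A dyadic partition of unity `(χ, θ)` on `ℝ`. -/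
structure IsDyadicPartition (χ θ : ℝ → ℝ) : Prop where
  smooth_chi : ContDiff ℝ (⊤ : ℕ∞) χ
  smooth_theta : ContDiff ℝ (⊤ : ℕ∞) θ
  nonneg_chi : ∀ z, 0 ≤ χ z
  nonneg_theta : ∀ z, 0 ≤ θ z
  even_chi : ∀ z, χ (-z) = χ z
  even_theta : ∀ z, θ (-z) = θ z
  chi_support : ∃ R > 0, ∀ z, R ≤ |z| → χ z = 0
  theta_support : ∃ r R : ℝ, 0 < r ∧ r < R ∧ ∀ z, (|z| < r ∨ R < |z|) → θ z = 0
  partition : ∀ z : ℝ, χ z + ∑' j : ℕ, θ ((2 : ℝ) ^ (-(j : ℤ)) * z) = 1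
  chi_theta_disj : ∀ j : ℕ, 1 ≤ j → ∀ z, χ z * θ ((2 : ℝ) ^ (-(j : ℤ)) * z) = 0
  theta_theta_disj : ∀ i j : ℕ, 1 < |(i : ℤ) - (j : ℤ)| → ∀ z,
    θ ((2 : ℝ) ^ (-(i : ℤ)) * z) * θ ((2 : ℝ) ^ (-(j : ℤ)) * z) = 0

/-- The Fourier multiplier symbol of the vertical Littlewood–Paley block `Δ^v_j`. -/
def blockSymb (χ θ : ℝ → ℝ) (j : ℤ) (z : ℝ) : ℝ :=
  if j = -1 then χ |z| else if 0 ≤ j then θ ((2 : ℝ) ^ (-j) * |z|) else 0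

/-- The Fourier multiplier symbol of the vertical low-frequency cut-off `S^v_j`. -/
def lowSymb (χ θ : ℝ → ℝ) (j : ℤ) (z : ℝ) : ℝ :=
  ∑ j' ∈ Finset.Icc (-1 : ℤ) (j - 2), blockSymb χ θ j' z

/-- The character `e^{ik·x}`. -/
def eK (k : ℤ × ℤ) (x : ℝ × ℝ) : ℂ :=
  Complex.exp (Complex.I * ((k.1 : ℂ) * (x.1 : ℂ) + (k.2 : ℂ) * (x.2 : ℂ)))

/-- Vertical Littlewood–Paley block `Δ^v_j` of a complex-valued function. -/
def LPC (χ θ : ℝ → ℝ) (j : ℤ) (f : ℝ × ℝ → ℂ) : ℝ × ℝ → ℂ :=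
  fun x => ∑' k : ℤ × ℤ, (blockSymb χ θ j k.2 : ℂ) * fcC f k * eK k x

/-- Vertical Littlewood–Paley block `Δ^v_j` of a real-valued function. -/
def LP (χ θ : ℝ → ℝ) (j : ℤ) (f : ℝ × ℝ → ℝ) : ℝ × ℝ → ℂ :=
  LPC χ θ j fun x => (f x : ℂ)

/-- Vertical low-frequency cut-off `S^v_j` of a complex-valued function. -/
def SvC (χ θ : ℝ → ℝ) (j : ℤ) (f : ℝ × ℝ → ℂ) : ℝ × ℝ → ℂ :=
  fun x => ∑' k : ℤ × ℤ, (lowSymb χ θ j k.2 : ℂ) * fcC f k * eK k x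

/-- Vertical low-frequency cut-off `S^v_j` of a real-valued function. -/
def Sv (χ θ : ℝ → ℝ) (j : ℤ) (f : ℝ × ℝ → ℝ) : ℝ × ℝ → ℂ :=
  SvC χ θ j fun x => (f x : ℂ)

/-- Componentwise Littlewood–Paley block of a vector field. -/
def LPV (χ θ : ℝ → ℝ) (j : ℤ) (u : ℝ × ℝ → ℝ × ℝ) : ℝ × ℝ → ℂ × ℂ :=
  fun x => (LP χ θ j (comp1 u) x, LP χ θ j (comp2 u) x)

/-- Componentwise low-frequency cut-off of a vector field. -/
def SvV (χ θ : ℝ → ℝ) (j : ℤ) (u : ℝ × ℝ → ℝ × ℝ) : ℝ × ℝ → ℂ × ℂ :=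
  fun x => (Sv χ θ j (comp1 u) x, Sv χ θ j (comp2 u) x)

/-- L² inner product of complex-valued functions on the torus. -/
def ipC (f g : ℝ × ℝ → ℂ) : ℂ := ∫ x in Q2, f x * (starRingEnd ℂ) (g x)

/-- L² inner product of complex vector fields on the torus (summed over components). -/
def ipCV (f g : ℝ × ℝ → ℂ × ℂ) : ℂ :=
  ∫ x in Q2, ((f x).1 * (starRingEnd ℂ) ((g x).1) + (f x).2 * (starRingEnd ℂ) ((g x).2))

/-- The vertical paraproduct `T^v_a g = Σ_j S^v_{j-1}a · Δ^v_j g`. -/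
def Tv (χ θ : ℝ → ℝ) (a g : ℝ × ℝ → ℝ) : ℝ × ℝ → ℂ :=
  fun x => ∑' j : ℤ, Sv χ θ (j - 1) a x * LP χ θ j g x

/-- The vertical remainder `R^v(a,g) = Σ_{|j-j'|≤1} Δ^v_j a · Δ^v_{j'} g`. -/
def Rv (χ θ : ℝ → ℝ) (a g : ℝ × ℝ → ℝ) : ℝ × ℝ → ℂ :=
  fun x => ∑' p : ℤ × ℤ, if |p.1 - p.2| ≤ 1 then LP χ θ p.1 a x * LP χ θ p.2 g x else 0


section Integration

lemma measurableSet_I2pi : MeasurableSet I2pi := measurableSet_Ioc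

lemma integral_I2pi {E : Type*} [NormedAddCommGroup E] [NormedSpace ℝ E] (f : ℝ → E) :
    ∫ x in I2pi, f x = ∫ x in (0 : ℝ)..(2 * π), f x :=
  (intervalIntegral.integral_of_le (by positivity)).symm

lemma restrict_Q2 : (volume.restrict Q2 : Measure (ℝ × ℝ)) =
    (volume.restrict I2pi).prod (volume.restrict I2pi) :=
  (Measure.prod_restrict I2pi I2pi).symm

lemma integrableOn_I2pi {E : Type*} [NormedAddCommGroup E] {f : ℝ → E} (hf : Continuous f) :
    IntegrableOn f I2pi :=
  (hf.continuousOn.integrableOn_compact isCompact_Icc).mono_set Ioc_subset_Icc_self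

lemma integrableOn_Q2 {E : Type*} [NormedAddCommGroup E] {f : ℝ × ℝ → E} (hf : Continuous f) :
    IntegrableOn f Q2 :=
  (hf.continuousOn.integrableOn_compact
    ((isCompact_Icc (a := (0 : ℝ)) (b := 2 * π)).prod
      (isCompact_Icc (a := (0 : ℝ)) (b := 2 * π)))).mono_set
    (prod_mono Ioc_subset_Icc_self Ioc_subset_Icc_self)

lemma integral_Q2 {E : Type*} [NormedAddCommGroup E] [NormedSpace ℝ E] {f : ℝ × ℝ → E}
    (hf : Continuous f) : ∫ x in Q2, f x = ∫ x₁ in I2pi, ∫ x₂ in I2pi, f (x₁, x₂) :=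
  setIntegral_prod f (integrableOn_Q2 hf)

lemma integral_Q2_symm {E : Type*} [NormedAddCommGroup E] [NormedSpace ℝ E] {f : ℝ × ℝ → E}
    (hf : Continuous f) : ∫ x in Q2, f x = ∫ x₂ in I2pi, ∫ x₁ in I2pi, f (x₁, x₂) := by
  have h := integrableOn_Q2 hf
  rw [IntegrableOn, restrict_Q2] at h
  rw [restrict_Q2, integral_prod_symm f h]

lemma continuous_integral_snd {E : Type*} [NormedAddCommGroup E] [NormedSpace ℝ E]
    {f : ℝ × ℝ → E} (hf : Continuous f) : Continuous fun x₁ => ∫ x₂ in I2pi, f (x₁, x₂) := by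
  simp only [integral_I2pi]
  exact intervalIntegral.continuous_parametric_intervalIntegral_of_continuous'
    (f := fun x₁ x₂ => f (x₁, x₂)) hf _ _

lemma continuous_integral_fst {E : Type*} [NormedAddCommGroup E] [NormedSpace ℝ E]
    {f : ℝ × ℝ → E} (hf : Continuous f) : Continuous fun x₂ => ∫ x₁ in I2pi, f (x₁, x₂) :=
  continuous_integral_snd (hf.comp continuous_swap)

lemma tintR_nonneg {f : ℝ × ℝ → ℝ} (hf : ∀ x, 0 ≤ f x) : 0 ≤ tintR f :=
  integral_nonneg hf

lemma tintR_add {f g : ℝ × ℝ → ℝ} (hf : Continuous f) (hg : Continuous g) :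
    tintR (fun x => f x + g x) = tintR f + tintR g :=
  integral_add (integrableOn_Q2 hf) (integrableOn_Q2 hg)

lemma tintR_const_mul (c : ℝ) (f : ℝ × ℝ → ℝ) : tintR (fun x => c * f x) = c * tintR f :=
  integral_const_mul c f

lemma tintR_mono {f g : ℝ × ℝ → ℝ} (hf : Continuous f) (hg : Continuous g)
    (h : ∀ x, f x ≤ g x) : tintR f ≤ tintR g :=
  integral_mono (integrableOn_Q2 hf) (integrableOn_Q2 hg) h

lemma abs_tintR_le (f : ℝ × ℝ → ℝ) : |tintR f| ≤ tintR fun x => |f x| :=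
  abs_integral_le_integral_abs

end Integration

section Derivatives

lemma Smooth.continuous {f : ℝ × ℝ → ℝ} (hf : Smooth f) : Continuous f := ContDiff.continuous hf

lemma Smooth.pd1 {f : ℝ × ℝ → ℝ} (hf : Smooth f) : Smooth (pd1 f) :=
  (ContDiff.fderiv_right (m := (⊤ : ℕ∞)) hf (by simp)).clm_apply contDiff_const

lemma Smooth.pd2 {f : ℝ × ℝ → ℝ} (hf : Smooth f) : Smooth (pd2 f) :=
  (ContDiff.fderiv_right (m := (⊤ : ℕ∞)) hf (by simp)).clm_apply contDiff_const

lemma SmoothV.comp1 {u : ℝ × ℝ → ℝ × ℝ} (hu : SmoothV u) : Smooth (comp1 u) := ContDiff.fst hu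

lemma SmoothV.comp2 {u : ℝ × ℝ → ℝ × ℝ} (hu : SmoothV u) : Smooth (comp2 u) := ContDiff.snd hu

lemma Smooth.hasDerivAt_fst {f : ℝ × ℝ → ℝ} (hf : Smooth f) (x₁ x₂ : ℝ) :
    HasDerivAt (fun s => f (s, x₂)) (Aniso.pd1 f (x₁, x₂)) x₁ :=
  ((ContDiff.differentiable hf (by simp)).differentiableAt (x := (x₁, x₂))).hasFDerivAt
    |>.comp_hasDerivAt x₁ ((hasDerivAt_id x₁).prodMk (hasDerivAt_const x₁ x₂))

lemma Smooth.hasDerivAt_snd {f : ℝ × ℝ → ℝ} (hf : Smooth f) (x₁ x₂ : ℝ) :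
    HasDerivAt (fun t => f (x₁, t)) (Aniso.pd2 f (x₁, x₂)) x₂ :=
  ((ContDiff.differentiable hf (by simp)).differentiableAt (x := (x₁, x₂))).hasFDerivAt
    |>.comp_hasDerivAt x₂ ((hasDerivAt_const x₂ x₁).prodMk (hasDerivAt_id x₂))

lemma Smooth.per_pd1 {f : ℝ × ℝ → ℝ} (hf : Smooth f) (hp : Per f) : Per (Aniso.pd1 f) := by
  refine ⟨fun x => ?_, fun x => ?_⟩
  · refine HasDerivAt.unique ((hf.hasDerivAt_fst (x.1 + 2 * π) x.2).comp_add_const x.1 (2 * π)) ?_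
    exact (hf.hasDerivAt_fst x.1 x.2).congr_of_eventuallyEq (.of_forall fun s => hp.1 (s, x.2))
  · refine HasDerivAt.unique (hf.hasDerivAt_fst x.1 (x.2 + 2 * π)) ?_
    exact (hf.hasDerivAt_fst x.1 x.2).congr_of_eventuallyEq (.of_forall fun s => hp.2 (s, x.2))

lemma Smooth.per_pd2 {f : ℝ × ℝ → ℝ} (hf : Smooth f) (hp : Per f) : Per (Aniso.pd2 f) := by
  refine ⟨fun x => ?_, fun x => ?_⟩
  · refine HasDerivAt.unique (hf.hasDerivAt_snd (x.1 + 2 * π) x.2) ?_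
    exact (hf.hasDerivAt_snd x.1 x.2).congr_of_eventuallyEq (.of_forall fun t => hp.1 (x.1, t))
  · refine HasDerivAt.unique ((hf.hasDerivAt_snd x.1 (x.2 + 2 * π)).comp_add_const x.2 (2 * π)) ?_
    exact (hf.hasDerivAt_snd x.1 x.2).congr_of_eventuallyEq (.of_forall fun t => hp.2 (x.1, t))

end Derivatives

section Anisotropic

/-- One-dimensional Agmon-type bound: a `C¹` function is controlled pointwise by its `L²` norm and
that of its derivative, with an arbitrarily small weight on the derivative. -/
lemma sq_le_integral {h h' : ℝ → ℝ} (hh : ∀ x, HasDerivAt h (h' x) x) (hc : Continuous h')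
    {β : ℝ} (hβ : 0 < β) {x : ℝ} (hx : x ∈ I2pi) :
    h x ^ 2 ≤ ∫ y in I2pi, ((1 + 1 / β) * h y ^ 2 + β * h' y ^ 2) := by
  have hcont : Continuous h := continuous_iff_continuousAt.2 fun x => (hh x).continuousAt
  set K : ℝ := ∫ y in I2pi, |2 * h y * h' y| with hK
  have hdiff : ∀ y ∈ I2pi, h x ^ 2 - K ≤ h y ^ 2 := by
    intro y hy
    have hftc : ∫ t in y..x, 2 * h t * h' t = h x ^ 2 - h y ^ 2 :=
      intervalIntegral.integral_eq_sub_of_hasDerivAt (f := fun t => h t ^ 2)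
        (fun t _ => by simpa using! (hh t).pow 2)
        ((by fun_prop : Continuous fun t => 2 * h t * h' t).intervalIntegrable _ _)
    have hle : |∫ t in y..x, 2 * h t * h' t| ≤ K := by
      rw [← Real.norm_eq_abs]
      refine intervalIntegral.norm_integral_le_integral_norm_uIoc.trans ?_
      refine setIntegral_mono_set (integrableOn_I2pi (by fun_prop))
        (ae_of_all _ fun _ => abs_nonneg _) (LE.le.eventuallyLE ?_)
      intro t ht
      exact ⟨(le_min hy.1.le hx.1.le).trans_lt ht.1, ht.2.trans (max_le hy.2 hx.2)⟩
    linarith [le_abs_self (∫ t in y..x, 2 * h t * h' t)]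
  have hint : (2 * π) * (h x ^ 2 - K) ≤ ∫ y in I2pi, h y ^ 2 := by
    have := setIntegral_mono_on (integrableOn_I2pi (continuous_const (y := h x ^ 2 - K)))
      (integrableOn_I2pi (hcont.pow 2)) measurableSet_I2pi hdiff
    rw [integral_I2pi (fun _ => h x ^ 2 - K)] at this
    rwa [intervalIntegral.integral_const, sub_zero, smul_eq_mul] at this
  have hnn : 0 ≤ ∫ y in I2pi, h y ^ 2 := integral_nonneg fun y => sq_nonneg _
  have h1 : h x ^ 2 - K ≤ ∫ y in I2pi, h y ^ 2 := by
    by_contra! hlt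
    nlinarith [pi_gt_three]
  have hKle : K ≤ ∫ y in I2pi, (1 / β * h y ^ 2 + β * h' y ^ 2) := by
    refine integral_mono (integrableOn_I2pi (by fun_prop)) (integrableOn_I2pi (by fun_prop)) ?_
    intro y
    have e : 1 / β * h y ^ 2 + β * h' y ^ 2 - 2 * h y * h' y = (1 / β) * (h y - β * h' y) ^ 2 := by
      field_simp; ring
    have e' : 1 / β * h y ^ 2 + β * h' y ^ 2 + 2 * h y * h' y = (1 / β) * (h y + β * h' y) ^ 2 := by
      field_simp; ring
    have p : 0 ≤ (1 / β) * (h y - β * h' y) ^ 2 := by positivity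
    have p' : 0 ≤ (1 / β) * (h y + β * h' y) ^ 2 := by positivity
    exact abs_le.2 ⟨by linarith, by linarith⟩
  calc h x ^ 2 ≤ (∫ y in I2pi, h y ^ 2) + ∫ y in I2pi, (1 / β * h y ^ 2 + β * h' y ^ 2) := by
        linarith
    _ = ∫ y in I2pi, ((1 + 1 / β) * h y ^ 2 + β * h' y ^ 2) := by
        rw [← integral_add (integrableOn_I2pi (by fun_prop)) (integrableOn_I2pi (by fun_prop))]
        congr 1 with y
        ring

/-- Anisotropic product estimate: horizontal regularity of `f` and vertical regularity of `g`
bound the `L²` norm of `f g`. -/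
lemma tintR_sq_mul_sq_le {f g : ℝ × ℝ → ℝ} (hf : Smooth f) (hg : Smooth g) {β γ : ℝ}
    (hβ : 0 < β) (hγ : 0 < γ) :
    tintR (fun x => f x ^ 2 * g x ^ 2) ≤
      ((1 + 1 / β) * tintR (fun x => f x ^ 2) + β * tintR (fun x => pd1 f x ^ 2)) *
      ((1 + 1 / γ) * tintR (fun x => g x ^ 2) + γ * tintR (fun x => pd2 g x ^ 2)) := by
  have cf := hf.continuous
  have cg := hg.continuous
  have cf' := hf.pd1.continuous
  have cg' := hg.pd2.continuous
  set φ : ℝ × ℝ → ℝ := fun x => (1 + 1 / β) * f x ^ 2 + β * pd1 f x ^ 2 with hφ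
  set ψ : ℝ × ℝ → ℝ := fun x => (1 + 1 / γ) * g x ^ 2 + γ * pd2 g x ^ 2 with hψ
  have cφ : Continuous φ := by fun_prop
  have cψ : Continuous ψ := by fun_prop
  set Φ : ℝ → ℝ := fun x₂ => ∫ x₁ in I2pi, φ (x₁, x₂)
  set Ψ : ℝ → ℝ := fun x₁ => ∫ x₂ in I2pi, ψ (x₁, x₂)
  have cΦ : Continuous Φ := continuous_integral_fst cφ
  have cΨ : Continuous Ψ := continuous_integral_snd cψ
  have eφ : tintR φ =
      (1 + 1 / β) * tintR (fun x => f x ^ 2) + β * tintR (fun x => pd1 f x ^ 2) := by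
    rw [hφ, tintR_add (by fun_prop) (by fun_prop), tintR_const_mul, tintR_const_mul]
  have eψ : tintR ψ =
      (1 + 1 / γ) * tintR (fun x => g x ^ 2) + γ * tintR (fun x => pd2 g x ^ 2) := by
    rw [hψ, tintR_add (by fun_prop) (by fun_prop), tintR_const_mul, tintR_const_mul]
  rw [← eφ, ← eψ]
  have hprod : ∫ x in Q2, Ψ x.1 * Φ x.2 = tintR φ * tintR ψ := by
    rw [tintR, tintR, integral_Q2_symm cφ, integral_Q2 cψ, mul_comm]
    exact setIntegral_prod_mul Ψ Φ I2pi I2pi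
  rw [← hprod]
  refine setIntegral_mono_on (integrableOn_Q2 (by fun_prop)) (integrableOn_Q2 (by fun_prop))
    (measurableSet_I2pi.prod measurableSet_I2pi) fun x hx => ?_
  have h1 : f x ^ 2 ≤ Φ x.2 :=
    sq_le_integral (h := fun s => f (s, x.2)) (fun s => hf.hasDerivAt_fst s x.2)
      (by fun_prop) hβ hx.1
  have h2 : g x ^ 2 ≤ Ψ x.1 :=
    sq_le_integral (h := fun t => g (x.1, t)) (fun t => hg.hasDerivAt_snd x.1 t)
      (by fun_prop) hγ hx.2
  rw [mul_comm]
  exact mul_le_mul h2 h1 (sq_nonneg _) ((sq_nonneg _).trans h2)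

end Anisotropic

section Fourier

lemma fc1_eq_fourierCoeffOn (g : ℝ → ℂ) (n : ℤ) :
    fc1 g n = fourierCoeffOn Real.two_pi_pos g n := by
  rw [fourierCoeffOn_eq_integral, fc1, integral_I2pi, real_smul]
  congr 1
  · simp
  · congr 1 with x
    rw [fourier_coe_apply, smul_eq_mul, mul_comm]
    congr 2
    have : (π : ℂ) ≠ 0 := by exact_mod_cast pi_ne_zero
    push_cast
    field_simp
    ring

lemma hasSum_sq_fc1 {g : ℝ → ℂ} (hg : Continuous g) :
    HasSum (fun n => ‖fc1 g n‖ ^ 2) ((2 * π)⁻¹ * ∫ x in I2pi, ‖g x‖ ^ 2) := by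
  have hL2 : MemLp g 2 (volume.restrict (Ioc 0 (2 * π))) :=
    (memLp_two_iff_integrable_sq_norm hg.aestronglyMeasurable).2 (integrableOn_I2pi (by fun_prop))
  simpa only [fc1_eq_fourierCoeffOn, integral_I2pi, sub_zero, smul_eq_mul] using
    hasSum_sq_fourierCoeffOn Real.two_pi_pos hL2

lemma fc1_deriv {g g' : ℝ → ℂ} (hg : ∀ x, HasDerivAt g (g' x) x) (hc : Continuous g')
    (hp : g (2 * π) = g 0) (n : ℤ) : fc1 g' n = I * n * fc1 g n := by
  rcases eq_or_ne n 0 with rfl | hn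
  · have : ∫ x in I2pi, g' x = 0 := by
      rw [integral_I2pi, intervalIntegral.integral_eq_sub_of_hasDerivAt (fun x _ => hg x)
        (hc.intervalIntegrable _ _), hp, sub_self]
    simp [fc1, this]
  · rw [fc1_eq_fourierCoeffOn, fc1_eq_fourierCoeffOn, fourierCoeffOn_of_hasDerivAt Real.two_pi_pos hn
      (fun x _ => hg x) (hc.intervalIntegrable _ _), hp]
    have : (π : ℂ) ≠ 0 := by exact_mod_cast pi_ne_zero
    have : (n : ℂ) ≠ 0 := by exact_mod_cast hn
    have := I_ne_zero
    push_cast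
    field_simp
    ring

lemma fc1_const_mul (c : ℂ) (g : ℝ → ℂ) (n : ℤ) : fc1 (fun x => c * g x) n = c * fc1 g n := by
  simp only [fc1, mul_assoc, integral_const_mul]
  ring

lemma fcC_eq_fc1_fc1 {F : ℝ × ℝ → ℂ} (hF : Continuous F) (k : ℤ × ℤ) :
    fcC F k = fc1 (fun x₁ => fc1 (fun x₂ => F (x₁, x₂)) k.2) k.1 := by
  rw [fcC, integral_Q2 (by fun_prop), fc1, one_div, one_div, sq, mul_inv, mul_assoc,
    ← integral_const_mul]
  congr 2 with x₁
  simp only [fc1]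
  rw [one_div, mul_assoc, ← integral_mul_const]
  congr 2 with x₂
  rw [mul_assoc, ← Complex.exp_add]
  ring_nf

lemma fcC_eq_fc1_fc1_symm {F : ℝ × ℝ → ℂ} (hF : Continuous F) (k : ℤ × ℤ) :
    fcC F k = fc1 (fun x₂ => fc1 (fun x₁ => F (x₁, x₂)) k.1) k.2 := by
  rw [fcC, integral_Q2_symm (by fun_prop), fc1, one_div, one_div, sq, mul_inv, mul_assoc,
    ← integral_const_mul]
  congr 2 with x₂
  simp only [fc1]
  rw [one_div, mul_assoc, ← integral_mul_const]
  congr 2 with x₁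
  rw [mul_assoc, ← Complex.exp_add]
  ring_nf

lemma continuous_fc1_snd {F : ℝ × ℝ → ℂ} (hF : Continuous F) (n : ℤ) :
    Continuous fun x₁ => fc1 (fun x₂ => F (x₁, x₂)) n :=
  continuous_const.mul (continuous_integral_snd
    (f := fun x => F x * Complex.exp (-(Complex.I) * ((n : ℂ) * (x.2 : ℂ)))) (by fun_prop))

/-- Parseval's identity on the torus for continuous functions. -/
lemma hasSum_sq_fcC {F : ℝ × ℝ → ℂ} (hF : Continuous F) :
    HasSum (fun k => ‖fcC F k‖ ^ 2) (((2 * π) ^ 2)⁻¹ * ∫ x in Q2, ‖F x‖ ^ 2) := by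
  have hrow (n : ℤ) := hasSum_sq_fc1 (continuous_fc1_snd hF n)
  have hslice (x₁ : ℝ) : HasSum (fun n => ‖fc1 (fun x₂ => F (x₁, x₂)) n‖ ^ 2)
      ((2 * π)⁻¹ * ∫ x₂ in I2pi, ‖F (x₁, x₂)‖ ^ 2) :=
    hasSum_sq_fc1 (g := fun x₂ => F (x₁, x₂)) (by fun_prop)
  have hcol : HasSum (fun n : ℤ => ∫ x₁ in I2pi, ‖fc1 (fun x₂ => F (x₁, x₂)) n‖ ^ 2)
      (∫ x₁ in I2pi, (2 * π)⁻¹ * ∫ x₂ in I2pi, ‖F (x₁, x₂)‖ ^ 2) := by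
    refine hasSum_integral_of_dominated_convergence
      (fun n x₁ => ‖fc1 (fun x₂ => F (x₁, x₂)) n‖ ^ 2)
      (fun n => ((continuous_fc1_snd hF n).norm.pow 2).aestronglyMeasurable)
      (fun n => ae_of_all _ fun x₁ => by simp)
      (ae_of_all _ fun x₁ => (hslice x₁).summable) ?_ (ae_of_all _ hslice)
    simp only [(hslice _).tsum_eq]
    exact integrableOn_I2pi (continuous_const.mul
      (continuous_integral_snd (f := fun x => ‖F x‖ ^ 2) (by fun_prop)))
  have hcol' := hcol.mul_left (2 * π)⁻¹
  have hswap : HasSum (fun p : ℤ × ℤ => ‖fcC F p.swap‖ ^ 2)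
      ((2 * π)⁻¹ * ∫ x₁ in I2pi, (2 * π)⁻¹ * ∫ x₂ in I2pi, ‖F (x₁, x₂)‖ ^ 2) := by
    simp only [fcC_eq_fc1_fc1 hF, Prod.fst_swap, Prod.snd_swap]
    have hs : Summable fun p : ℤ × ℤ => ‖fc1 (fun x₁ => fc1 (fun x₂ => F (x₁, x₂)) p.1) p.2‖ ^ 2 :=
      (summable_prod_of_nonneg fun p => sq_nonneg _).2
        ⟨fun n => (hrow n).summable, by simpa only [(hrow _).tsum_eq] using hcol'.summable⟩
    have := hs.hasSum.prod_fiberwise hrow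
    rw [← this.unique hcol']
    exact hs.hasSum
  rw [integral_const_mul, ← mul_assoc, ← mul_inv, ← sq,
    ← integral_Q2 (f := fun x => ‖F x‖ ^ 2) (by fun_prop)] at hswap
  exact (Equiv.prodComm ℤ ℤ).hasSum_iff.1 hswap

lemma hasSum_sq_fc {f : ℝ × ℝ → ℝ} (hf : Continuous f) :
    HasSum (fun k => ‖fc f k‖ ^ 2) (((2 * π) ^ 2)⁻¹ * tintR fun x => f x ^ 2) := by
  simpa [tintR, fc] using hasSum_sq_fcC (F := fun x => (f x : ℂ)) (by fun_prop)

lemma fc_pd1 {f : ℝ × ℝ → ℝ} (hf : Smooth f) (hp : Per f) (k : ℤ × ℤ) :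
    fc (pd1 f) k = I * k.1 * fc f k := by
  have cf := hf.continuous
  have cf' := hf.pd1.continuous
  rw [fc, fc, fcC_eq_fc1_fc1_symm (by fun_prop), fcC_eq_fc1_fc1_symm (by fun_prop),
    ← fc1_const_mul]
  congr 1 with x₂
  refine fc1_deriv (fun x₁ => (hf.hasDerivAt_fst x₁ x₂).ofReal_comp) (by fun_prop) ?_ _
  simpa using congrArg Complex.ofReal (hp.1 (0, x₂))

lemma fc_pd2 {f : ℝ × ℝ → ℝ} (hf : Smooth f) (hp : Per f) (k : ℤ × ℤ) :
    fc (pd2 f) k = I * k.2 * fc f k := by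
  have cf := hf.continuous
  have cf' := hf.pd2.continuous
  rw [fc, fc, fcC_eq_fc1_fc1 (by fun_prop), fcC_eq_fc1_fc1 (by fun_prop), ← fc1_const_mul]
  congr 1 with x₁
  refine fc1_deriv (fun x₂ => (hf.hasDerivAt_snd x₁ x₂).ofReal_comp) (by fun_prop) ?_ _
  simpa using congrArg Complex.ofReal (hp.2 (x₁, 0))

/-- The `H^{1,1}` norm in physical space. -/
lemma HSq_one_one {f : ℝ × ℝ → ℝ} (hf : Smooth f) (hp : Per f) :
    (2 * π) ^ 2 * HSq 1 1 f = tintR (fun x => f x ^ 2) + tintR (fun x => pd1 f x ^ 2) +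
      tintR (fun x => pd2 f x ^ 2) + tintR (fun x => pd2 (pd1 f) x ^ 2) := by
  have h := ((hasSum_sq_fc hf.continuous).add (hasSum_sq_fc hf.pd1.continuous)).add
    (hasSum_sq_fc hf.pd2.continuous) |>.add (hasSum_sq_fc hf.pd1.pd2.continuous)
  have e : HSq 1 1 f = _ := Eq.trans (tsum_congr fun k => ?_) h.tsum_eq
  · rw [e]
    field_simp
  · rw [fc_pd2 hf.pd1 (hf.per_pd1 hp), fc_pd2 hf hp, fc_pd1 hf hp]
    simp only [aw, rpow_one, norm_mul, norm_I, norm_intCast, mul_pow, sq_abs]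
    ring

/-- The mixed derivatives `∂₁∂₂f` and `∂₂∂₁f` have the same `L²` norm. -/
lemma tintR_sq_pd1_pd2 {f : ℝ × ℝ → ℝ} (hf : Smooth f) (hp : Per f) :
    tintR (fun x => pd1 (pd2 f) x ^ 2) = tintR (fun x => pd2 (pd1 f) x ^ 2) := by
  have h : HasSum (fun k => ‖fc (pd1 (pd2 f)) k‖ ^ 2) _ := hasSum_sq_fc hf.pd2.pd1.continuous
  have hfc : fc (pd1 (pd2 f)) = fc (pd2 (pd1 f)) := by
    ext k
    rw [fc_pd2 hf.pd1 (hf.per_pd1 hp), fc_pd1 hf.pd2 (hf.per_pd2 hp), fc_pd2 hf hp, fc_pd1 hf hp]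
    ring
  rw [hfc] at h
  exact mul_left_cancel₀ (by positivity) (h.unique (hasSum_sq_fc hf.pd1.pd2.continuous))

end Fourier

section Trilinear

lemma abs_tintR_mul_mul_le {f w g : ℝ × ℝ → ℝ} (hf : Continuous f) (hw : Continuous w)
    (hg : Continuous g) {P : ℝ} (hP : 0 < P) :
    |tintR fun x => f x * w x * g x| ≤
      (P⁻¹ * tintR (fun x => g x ^ 2 * w x ^ 2) + P * tintR (fun x => f x ^ 2)) / 2 := by
  have key : tintR (fun x => |f x * w x * g x|) ≤
      tintR fun x => (P⁻¹ / 2) * (g x ^ 2 * w x ^ 2) + (P / 2) * f x ^ 2 := by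
    refine tintR_mono (by fun_prop) (by fun_prop) fun x => ?_
    have e : (P⁻¹ / 2) * (g x ^ 2 * w x ^ 2) + (P / 2) * f x ^ 2 - f x * w x * g x =
        (P⁻¹ / 2) * (w x * g x - P * f x) ^ 2 := by field_simp; ring
    have e' : (P⁻¹ / 2) * (g x ^ 2 * w x ^ 2) + (P / 2) * f x ^ 2 + f x * w x * g x =
        (P⁻¹ / 2) * (w x * g x + P * f x) ^ 2 := by field_simp; ring
    have p : 0 ≤ (P⁻¹ / 2) * (w x * g x - P * f x) ^ 2 := by positivity
    have p' : 0 ≤ (P⁻¹ / 2) * (w x * g x + P * f x) ^ 2 := by positivity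
    exact abs_le.2 ⟨by linarith, by linarith⟩
  rw [tintR_add (by fun_prop) (by fun_prop), tintR_const_mul, tintR_const_mul] at key
  linarith [abs_tintR_le fun x => f x * w x * g x]

lemma HSq_nonneg (s s' : ℝ) (f : ℝ × ℝ → ℝ) : 0 ≤ HSq s s' f :=
  tsum_nonneg fun k => by unfold aw; positivity

/-- Horizontal transport by `f`: the horizontal regularity of `g` is used. -/
lemma abs_tintR_mul_pd1_mul_le {f φ g : ℝ × ℝ → ℝ} (hf : Smooth f) (hφ : Smooth φ) (hp : Per φ)
    (hg : Smooth g) {β P : ℝ} (hβ : 0 < β) (hP : 0 < P) (hN : HSq 1 1 φ ≤ P) :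
    |tintR fun x => f x * pd1 φ x * g x| ≤
      (8 * π ^ 2 * ((1 + 1 / β) * tintR (fun x => g x ^ 2) + β * tintR (fun x => pd1 g x ^ 2)) +
        P * tintR (fun x => f x ^ 2)) / 2 := by
  refine (abs_tintR_mul_mul_le hf.continuous hφ.pd1.continuous hg.continuous hP).trans ?_
  have h := tintR_sq_mul_sq_le hg hφ.pd1 hβ one_pos
  have hs := HSq_one_one hφ hp
  have n0 := tintR_nonneg fun x => sq_nonneg (φ x)
  have n2 := tintR_nonneg fun x => sq_nonneg (pd2 φ x)
  have n12 := tintR_nonneg fun x => sq_nonneg (pd2 (pd1 φ) x)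
  have g0 := tintR_nonneg fun x => sq_nonneg (g x)
  have g1 := tintR_nonneg fun x => sq_nonneg (pd1 g x)
  have hY : (1 + 1 / 1) * tintR (fun x => pd1 φ x ^ 2) +
      1 * tintR (fun x => pd2 (pd1 φ) x ^ 2) ≤ 8 * π ^ 2 * P := by
    have := mul_le_mul_of_nonneg_left hN (by positivity : 0 ≤ 8 * π ^ 2)
    linarith
  have := mul_le_mul_of_nonneg_left (h.trans (mul_le_mul_of_nonneg_left hY (by positivity)))
    (inv_nonneg.2 hP.le)
  have e (E : ℝ) : P⁻¹ * (E * (8 * π ^ 2 * P)) = 8 * π ^ 2 * E := by field_simp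
  rw [e] at this
  linarith

/-- Vertical transport by `f`: the vertical regularity of `f` is used. -/
lemma abs_tintR_mul_pd2_mul_le {f φ g : ℝ × ℝ → ℝ} (hf : Smooth f) (hφ : Smooth φ) (hp : Per φ)
    (hg : Smooth g) {β P : ℝ} (hβ : 0 < β) (hP : 0 < P) (hN : HSq 1 1 φ ≤ P) :
    |tintR fun x => f x * pd2 φ x * g x| ≤
      (8 * π ^ 2 * ((1 + 1 / β) * tintR (fun x => f x ^ 2) + β * tintR (fun x => pd2 f x ^ 2)) +
        P * tintR (fun x => g x ^ 2)) / 2 := by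
  have hcomm : (fun x => f x * pd2 φ x * g x) = fun x => g x * pd2 φ x * f x := by
    ext x; ring
  have hcomm' : (fun x => f x ^ 2 * pd2 φ x ^ 2) = fun x => pd2 φ x ^ 2 * f x ^ 2 := by
    ext x; ring
  rw [hcomm]
  refine (abs_tintR_mul_mul_le hg.continuous hφ.pd2.continuous hf.continuous hP).trans ?_
  have h := tintR_sq_mul_sq_le hφ.pd2 hf one_pos hβ
  rw [tintR_sq_pd1_pd2 hφ hp] at h
  have hs := HSq_one_one hφ hp
  have n0 := tintR_nonneg fun x => sq_nonneg (φ x)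
  have n1 := tintR_nonneg fun x => sq_nonneg (pd1 φ x)
  have n12 := tintR_nonneg fun x => sq_nonneg (pd2 (pd1 φ) x)
  have f0 := tintR_nonneg fun x => sq_nonneg (f x)
  have f2 := tintR_nonneg fun x => sq_nonneg (pd2 f x)
  have hY : (1 + 1 / 1) * tintR (fun x => pd2 φ x ^ 2) +
      1 * tintR (fun x => pd2 (pd1 φ) x ^ 2) ≤ 8 * π ^ 2 * P := by
    have := mul_le_mul_of_nonneg_left hN (by positivity : 0 ≤ 8 * π ^ 2)
    linarith
  have := mul_le_mul_of_nonneg_left (h.trans (mul_le_mul_of_nonneg_right hY (by positivity)))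
    (inv_nonneg.2 hP.le)
  have e (E : ℝ) : P⁻¹ * (8 * π ^ 2 * P * E) = 8 * π ^ 2 * E := by field_simp
  rw [e] at this
  rw [hcomm']
  linarith

lemma sq_L2V {u : ℝ × ℝ → ℝ × ℝ} (h₁ : Continuous (comp1 u)) (h₂ : Continuous (comp2 u)) :
    L2V u ^ 2 = tintR (fun x => comp1 u x ^ 2) + tintR (fun x => comp2 u x ^ 2) := by
  rw [L2V, sq_sqrt (tintR_nonneg fun x => by positivity), ← tintR_add (by fun_prop) (by fun_prop)]
  rfl

lemma sq_HNV (s s' : ℝ) (u : ℝ × ℝ → ℝ × ℝ) :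
    HNV s s' u ^ 2 = HSq s s' (comp1 u) + HSq s s' (comp2 u) :=
  sq_sqrt (add_nonneg (HSq_nonneg _ _ _) (HSq_nonneg _ _ _))

lemma b3_eq {u v w : ℝ × ℝ → ℝ × ℝ} (hu : SmoothV u) (hv : SmoothV v) (hw : SmoothV w) :
    b3 u v w = tintR (fun x => comp1 u x * pd1 (comp1 v) x * comp1 w x) +
      tintR (fun x => comp2 u x * pd2 (comp1 v) x * comp1 w x) +
      tintR (fun x => comp1 u x * pd1 (comp2 v) x * comp2 w x) +
      tintR (fun x => comp2 u x * pd2 (comp2 v) x * comp2 w x) := by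
  have := hu.comp1.continuous
  have := hu.comp2.continuous
  have := hw.comp1.continuous
  have := hw.comp2.continuous
  have := hv.comp1.pd1.continuous
  have := hv.comp1.pd2.continuous
  have := hv.comp2.pd1.continuous
  have := hv.comp2.pd2.continuous
  rw [← tintR_add (by fun_prop) (by fun_prop), ← tintR_add (by fun_prop) (by fun_prop),
    ← tintR_add (by fun_prop) (by fun_prop), b3, ipV]
  congr 1 with x
  simp only [advect, comp1, comp2]
  ring

end Trilinear

/-- For every `α > 0` there is `C_α > 0` such that for all smooth
divergence-free `u, v : 𝕋² → ℝ²`,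
`|b(u,v,u)| ≤ α ‖∂₁u‖²_{L²} + C_α (1 + ‖v‖²_{H^{1,1}}) ‖u‖²_{L²}`. -/
theorem b_uvu_estimate (α : ℝ) (hα : 0 < α) :
    ∃ C > 0, ∀ u v : ℝ × ℝ → ℝ × ℝ,
      SmoothV u → PerV u → DivFree u →
      SmoothV v → PerV v → DivFree v →
      |b3 u v u| ≤ α * L2V (pd1V u) ^ 2 + C * (1 + HNV 1 1 v ^ 2) * L2V u ^ 2 := by
  set β : ℝ := α / (16 * π ^ 2) with hβ_def
  have hβ : 0 < β := by positivity
  have hβα : 16 * π ^ 2 * β = α := by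
    rw [hβ_def]
    field_simp
  refine ⟨16 * π ^ 2 * (1 + 1 / β) + 2, by positivity, ?_⟩
  intro u v hu _ hdiv hv hpv _
  have n₁ := HSq_nonneg 1 1 (comp1 v)
  have n₂ := HSq_nonneg 1 1 (comp2 v)
  have a₁ := tintR_nonneg fun x => sq_nonneg (comp1 u x)
  have a₂ := tintR_nonneg fun x => sq_nonneg (comp2 u x)
  have d₂ : tintR (fun x => pd2 (comp2 u) x ^ 2) = tintR fun x => pd1 (comp1 u) x ^ 2 := by
    congr 1 with x
    rw [eq_neg_of_add_eq_zero_right (hdiv x), neg_sq]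
  have hD : L2V (pd1V u) ^ 2 =
      tintR (fun x => pd1 (comp1 u) x ^ 2) + tintR fun x => pd1 (comp2 u) x ^ 2 :=
    sq_L2V (u := pd1V u) hu.comp1.pd1.continuous hu.comp2.pd1.continuous
  have hd₁ : β * tintR (fun x => pd1 (comp1 u) x ^ 2) ≤ β * L2V (pd1V u) ^ 2 :=
    mul_le_mul_of_nonneg_left
      (by linarith [tintR_nonneg fun x => sq_nonneg (pd1 (comp2 u) x)]) hβ.le
  have hd₂ : β * tintR (fun x => pd1 (comp2 u) x ^ 2) ≤ β * L2V (pd1V u) ^ 2 :=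
    mul_le_mul_of_nonneg_left
      (by linarith [tintR_nonneg fun x => sq_nonneg (pd1 (comp1 u) x)]) hβ.le
  have hA := sq_L2V hu.comp1.continuous hu.comp2.continuous
  have hN := sq_HNV 1 1 v
  set A := L2V u ^ 2
  set D := L2V (pd1V u) ^ 2
  set P := 1 + HNV 1 1 v ^ 2 with hP
  have hP0 : 0 < P := by positivity
  have hA₁ : tintR (fun x => comp1 u x ^ 2) ≤ A := by linarith
  have hA₂ : tintR (fun x => comp2 u x ^ 2) ≤ A := by linarith
  have bound {T X Y Z : ℝ} (hT : T ≤ (8 * π ^ 2 * ((1 + 1 / β) * X + β * Y) + P * Z) / 2)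
      (hX : X ≤ A) (hY : β * Y ≤ β * D) (hZ : Z ≤ A) :
      T ≤ (8 * π ^ 2 * ((1 + 1 / β) * A + β * D) + P * A) / 2 := by
    refine hT.trans ?_
    gcongr
  have t₁ := bound (abs_tintR_mul_pd1_mul_le hu.comp1 hv.comp1 hpv.1 hu.comp1 hβ hP0
    (by linarith)) hA₁ hd₁ hA₁
  have t₂ := bound (abs_tintR_mul_pd2_mul_le hu.comp2 hv.comp1 hpv.1 hu.comp1 hβ hP0
    (by linarith)) hA₂ (d₂ ▸ hd₁) hA₁
  have t₃ := bound (abs_tintR_mul_pd1_mul_le hu.comp1 hv.comp2 hpv.2 hu.comp2 hβ hP0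
    (by linarith)) hA₂ hd₂ hA₁
  have t₄ := bound (abs_tintR_mul_pd2_mul_le hu.comp2 hv.comp2 hpv.2 hu.comp2 hβ hP0
    (by linarith)) hA₂ (d₂ ▸ hd₁) hA₂
  have hPA : A ≤ P * A := le_mul_of_one_le_left (by linarith) (by linarith)
  have hCA := mul_le_mul_of_nonneg_left hPA (by positivity : 0 ≤ 16 * π ^ 2 * (1 + 1 / β))
  rw [b3_eq hu hv hu]
  calc _ ≤ 4 * ((8 * π ^ 2 * ((1 + 1 / β) * A + β * D) + P * A) / 2) := by
        refine ((abs_add_le _ _).trans (add_le_add_left ((abs_add_le _ _).trans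
          (add_le_add_left (abs_add_le _ _) _)) _)).trans ?_
        linarith
    _ = 16 * π ^ 2 * β * D + 16 * π ^ 2 * (1 + 1 / β) * A + 2 * (P * A) := by ring
    _ ≤ α * D + (16 * π ^ 2 * (1 + 1 / β) + 2) * P * A := by
        rw [hβα]
        linarith

end Aniso
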